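/- A 1-Euclidean election with k candidates admits at most k(k−1)/2 + 1 distinct full rankings among its voters: if candidates are embedded as distinct points x_1, …, x_k in [0, 1] and each voter at position v ∈ [0, 1] ranks candidates by increasing distance |v − x_i| (with all such distances distinct for that voter), then the number of distinct rankings arising over all such voter positions v is at most k(k−1)/2 + 1. -/

import Mathlib

/-- The midpoints of the pairs of distinct points of the family `x`. -/
noncomputable def midpoints {k : ℕ} (x : Fin k → ℝ) : Finset ℝ :=
  ((Finset.univ : Finset (Fin k)).offDiag.image Sym2.mk.uncurry).image
    (Sym2.lift ⟨fun i j => (x i + x j) / 2, fun i j => by simp only [add_comm]⟩)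

theorem card_midpoints_le {k : ℕ} (x : Fin k → ℝ) :
    (midpoints x).card ≤ k * (k - 1) / 2 := by
  refine Finset.card_image_le.trans ?_
  rw [Sym2.card_image_offDiag, Finset.card_univ, Fintype.card_fin, Nat.choose_two_right]

theorem mem_midpoints {k : ℕ} (x : Fin k → ℝ) {i j : Fin k} (h : i ≠ j) :
    (x i + x j) / 2 ∈ midpoints x :=
  Finset.mem_image.2 ⟨s(i, j), Finset.mem_image.2 ⟨(i, j), by simp [h], rfl⟩, rfl⟩

theorem abs_sub_lt_abs_sub_iff_midpoint_lt {a b v : ℝ} (h : b < a) :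
    |v - a| < |v - b| ↔ (a + b) / 2 < v := by
  rw [← sq_lt_sq]
  constructor <;> intro h' <;> nlinarith

theorem lt_iff_lt_of_card_filter_lt_eq {α : Type*} [LinearOrder α] {s : Finset α} {v w : α}
    (h : (s.filter (· < v)).card = (s.filter (· < w)).card) {m : α} (hm : m ∈ s) :
    m < v ↔ m < w := by
  wlog hvw : v ≤ w generalizing v w
  · exact (this h.symm (le_of_not_ge hvw)).symm
  have hsub : s.filter (· < v) ⊆ s.filter (· < w) :=
    Finset.monotone_filter_right s fun _ _ ha => lt_of_lt_of_le ha hvw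
  have := Finset.ext_iff.1 (Finset.eq_of_subset_of_card_le hsub h.ge) m
  simpa [hm] using this

/-- Two voters without ties that lie to the right of equally many midpoints rank alike. -/
theorem abs_sub_lt_abs_sub_iff_of_card_midpoints_eq {k : ℕ} {x : Fin k → ℝ}
    (hinj : Function.Injective x) {v w : ℝ}
    (hv : ∀ i j : Fin k, i ≠ j → |v - x i| ≠ |v - x j|)
    (hw : ∀ i j : Fin k, i ≠ j → |w - x i| ≠ |w - x j|)
    (h : ((midpoints x).filter (· < v)).card = ((midpoints x).filter (· < w)).card)
    (i j : Fin k) : |v - x i| < |v - x j| ↔ |w - x i| < |w - x j| := by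
  have key : ∀ {i j : Fin k}, x j < x i →
      (|v - x i| < |v - x j| ↔ |w - x i| < |w - x j|) := fun {i j} hij => by
    rw [abs_sub_lt_abs_sub_iff_midpoint_lt hij, abs_sub_lt_abs_sub_iff_midpoint_lt hij]
    exact lt_iff_lt_of_card_filter_lt_eq h (mem_midpoints x fun e => hij.ne (by rw [e]))
  rcases eq_or_ne i j with rfl | hne
  · simp
  rcases lt_or_gt_of_ne (hinj.ne hne) with hlt | hgt
  · rw [← not_iff_not, not_lt, not_lt, (hv j i hne.symm).le_iff_lt, (hw j i hne.symm).le_iff_lt]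
    exact key hlt
  · exact key hgt

/-- A 1-Euclidean election with `k` candidates admits at most
`k(k-1)/2 + 1` distinct rankings: if the candidates are embedded as distinct points
`x 0, …, x (k-1)` of `[0, 1]`, and a voter at position `v ∈ [0, 1]` whose distances
to all candidates are pairwise distinct ranks candidates by increasing distance
(inducing the strict relation `R i j ↔ |v - x i| < |v - x j|`), then the number of
distinct induced rankings over all such voter positions is at most `k(k-1)/2 + 1`. -/
theorem one_euclidean_ranking_count (k : ℕ) (x : Fin k → ℝ)
    (hx : ∀ i, x i ∈ Set.Icc (0 : ℝ) 1) (hinj : Function.Injective x) :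
    Set.ncard {R : Fin k → Fin k → Prop |
        ∃ v ∈ Set.Icc (0 : ℝ) 1,
          (∀ i j : Fin k, i ≠ j → |v - x i| ≠ |v - x j|) ∧
          (∀ i j : Fin k, R i j ↔ |v - x i| < |v - x j|)} ≤
      k * (k - 1) / 2 + 1 := by
  set S := {R : Fin k → Fin k → Prop |
        ∃ v ∈ Set.Icc (0 : ℝ) 1,
          (∀ i j : Fin k, i ≠ j → |v - x i| ≠ |v - x j|) ∧
          (∀ i j : Fin k, R i j ↔ |v - x i| < |v - x j|)}
  have hex : ∀ R ∈ S, ∃ v : ℝ, (∀ i j : Fin k, i ≠ j → |v - x i| ≠ |v - x j|) ∧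
      (∀ i j : Fin k, R i j ↔ |v - x i| < |v - x j|) := fun R ⟨v, _, hv⟩ => ⟨v, hv⟩
  choose! pos hties hrank using hex
  let f : (Fin k → Fin k → Prop) → ℕ := fun R => ((midpoints x).filter (· < pos R)).card
  have hmaps : ∀ R ∈ S, f R ∈ (Finset.range (k * (k - 1) / 2 + 1) : Set ℕ) := fun R _ => by
    rw [Finset.mem_coe, Finset.mem_range, Nat.lt_succ_iff]
    exact (Finset.card_filter_le _ _).trans (card_midpoints_le x)
  have hf : Set.InjOn f S := fun R hR T hT hRT => by
    funext i j
    rw [eq_iff_iff, hrank R hR, hrank T hT]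
    exact abs_sub_lt_abs_sub_iff_of_card_midpoints_eq hinj (hties R hR) (hties T hT) hRT i j
  calc S.ncard ≤ (Finset.range (k * (k - 1) / 2 + 1) : Set ℕ).ncard :=
        Set.ncard_le_ncard_of_injOn f hmaps hf (Finset.finite_toSet _)
    _ = k * (k - 1) / 2 + 1 := by rw [Set.ncard_coe_finset, Finset.card_range]
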